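/- For every integer n ≥ 0, if M_{n,0} is a finite multiset of integers with ẽ(n, 0, 0) = h̃(M_{n,0}), then ẽ(n+1, 0, 0) = L(ẽ(n, 0, 0)) · h̃(M_{n,0} + M_{n,0}), where M_{n,0} + M_{n,0} is the multiset sum. -/

import Mathlib

open Finsupp

/-- `V` is the free ℤ-module with basis indexed by ℤ (finitely supported functions ℤ → ℤ). -/
abbrev V : Type := ℤ →₀ ℤ

/-- The basis element `h̃_j`. -/
noncomputable def ht (j : ℤ) : V := Finsupp.single j 1

/-- The product of two basis elements `h̃_A · h̃_B`:
`∑_{j=0}^{A} h̃_{B−A+2j}` for `A ≥ 0`; `0` for `A = −1`; `−(h̃_{−A−2} · h̃_B)` for `A ≤ −2`. -/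
noncomputable def basicMul (A B : ℤ) : V :=
  if 0 ≤ A then ∑ j ∈ Finset.range (A.toNat + 1), ht (B - A + 2 * (j : ℤ))
  else if A = -1 then 0
  else - ∑ j ∈ Finset.range ((-A - 2).toNat + 1), ht (B - (-A - 2) + 2 * (j : ℤ))

/-- The ℤ-bilinear product on `V` extending `basicMul` on basis elements. -/
noncomputable def mulV (g₁ g₂ : V) : V :=
  g₁.sum fun A cA => g₂.sum fun B cB => (cA * cB) • basicMul A B

/-- The shift operator `S_k`, with `S_k(h̃_j) = h̃_{j+k}`. -/
noncomputable def S (k : ℤ) (g : V) : V := Finsupp.mapDomain (fun j => j + k) g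

/-- Value of the map `L` on the basis element `h̃_j`. -/
noncomputable def Lb (j : ℤ) : V :=
  if 0 ≤ j then ht j else if j = -1 then 0 else - ht (-j - 2)

/-- The ℤ-linear map `L : V → V` with `L(h̃_j) = h̃_j` for `j ≥ 0`,
`L(h̃_{−1}) = 0`, `L(h̃_j) = −h̃_{−j−2}` for `j ≤ −2`. -/
noncomputable def Lmap (g : V) : V := g.sum fun j c => c • Lb j

/-- `W₀(g₁,g₂,g₃) = g₂ · (g₁ · g₃ − S_{−1}(g₁) · S_{−1}(g₃))`. -/
noncomputable def W0 (g₁ g₂ g₃ : V) : V :=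
  mulV g₂ (mulV g₁ g₃ - mulV (S (-1) g₁) (S (-1) g₃))

/-- `W₁(g₁,g₂,g₃) = S_{−1}(g₁)·g₂·g₃ + g₁·g₂·S_{−1}(g₃) − S_{−1}(g₁)·g₂·S_{−1}(g₃)`
(products associated to the left). -/
noncomputable def W1 (g₁ g₂ g₃ : V) : V :=
  mulV (mulV (S (-1) g₁) g₂) g₃ + mulV (mulV g₁ g₂) (S (-1) g₃)
    - mulV (mulV (S (-1) g₁) g₂) (S (-1) g₃)

/-- The multiset (Minkowski) sum `M₁ + M₂ = {i₁ + i₂ : i₁ ∈ M₁, i₂ ∈ M₂}`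
counted with multiplicity. -/
def msAdd (M₁ M₂ : Multiset ℤ) : Multiset ℤ := M₁.bind fun a => M₂.map fun b => a + b

/-- The multiset `[a, b] = {a, a+2, …, b−2, b}` (for `a ≤ b` with `a ≡ b (mod 2)`). -/
def iv (a b : ℤ) : Multiset ℤ :=
  (Multiset.range (((b - a) / 2).toNat + 1)).map fun j => a + 2 * (j : ℤ)

/-- `R(c)`: the set of finite multisets `M` of integers with
`mult(c−i−1, M) ≤ mult(c−i, M) ≤ mult(c+i, M)` for all `i ≥ 0`. -/
def Rset (c : ℤ) : Set (Multiset ℤ) :=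
  {M | ∀ i : ℤ, 0 ≤ i →
    M.count (c - i - 1) ≤ M.count (c - i) ∧ M.count (c - i) ≤ M.count (c + i)}

/-- `h̃(M) = ∑_{i ∈ ℤ} mult(i, M) · h̃_i ∈ V`. -/
noncomputable def hMS (M : Multiset ℤ) : V := (M.map ht).sum

/-- The triple `(ẽ(n,0,0), ẽ(n,1,0), ẽ(n,−1,0))`. -/
noncomputable def eZ : ℕ → V × V × V
  | 0 => (ht 2, ht 1, ht 1)
  | n + 1 =>
    let e0 := (eZ n).1
    let e1 := (eZ n).2.1
    let em := (eZ n).2.2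
    (mulV e0 (mulV e0 e0 - mulV e1 e1),
     mulV (mulV e1 e0) e0 + mulV (mulV e0 e0) e1
       - mulV (mulV (mulV e1 (ht 1)) e0) e1,
     mulV (mulV e1 e0) e0 + mulV (mulV e0 e0) e1
       - mulV (mulV (mulV e1 (ht 1)) e0) e1
       + mulV (mulV em em) (em - e1))

/-- The triple `(ẽ(n,0,1), ẽ(n,1,1), ẽ(n,−1,1))`. -/
noncomputable def eO : ℕ → V × V × V
  | 0 => (0, 0, ht 0)
  | n + 1 =>
    let e0 := (eZ n).1
    let e1 := (eO n).1
    let o1 := (eO n).2.1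
    let om := (eO n).2.2
    (W0 e0 e0 (e1 + S (-1) e0) + W0 e0 e1 e0 + W0 e1 e0 e0,
     W1 e0 e0 (e1 + S (-1) e0) + W1 e0 e1 e0 + W1 e1 e0 e0,
     W1 e0 e0 (e1 + S (-1) e0) + W1 e0 e1 e0
       + mulV (mulV om e0) e0 + mulV (mulV e1 e0) (S (-1) e0)
       - mulV (mulV (mulV om (ht 1)) e0) (S (-1) e0)
       + (2 : ℤ) • mulV (mulV (S (-1) e0) e0) (S (-1) e0)
       - mulV (mulV (mulV (S (-1) e0) (ht 1)) (S (-1) e0)) (S (-1) e0)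
       + mulV (mulV (S (-1) e0) (om - o1)) (S (-1) e0))

/-- `ẽ(n, i, 0)` for `i ∈ {−1, 0, 1}`. -/
noncomputable def etilde0 (n : ℕ) (i : ℤ) : V :=
  if i = 0 then (eZ n).1 else if i = 1 then (eZ n).2.1 else (eZ n).2.2

/-- `ẽ(n, i, 1)` for `i ∈ {−1, 0, 1}`. -/
noncomputable def etilde1 (n : ℕ) (i : ℤ) : V :=
  if i = 0 then (eO n).1 else if i = 1 then (eO n).2.1 else (eO n).2.2

open LaurentPolynomial in
/-- The identification of `V` with the Laurent polynomials, sending `h̃_j` to `T j`. -/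
noncomputable def toLaurentV : V ≃ₗ[ℤ] ℤ[T;T⁻¹] :=
  (AddMonoidAlgebra.coeffLinearEquiv ℤ).symm

open LaurentPolynomial in
/-- The Laurent polynomial by which left multiplication by an element of `V` acts. -/
noncomputable def character (f : V) : ℤ[T;T⁻¹] := toLaurentV (mulV f (ht 0))

section

open LaurentPolynomial

lemma toLaurentV_ht (j : ℤ) : toLaurentV (ht j) = T j := rfl

lemma T_sub_T_ne_zero : (T 1 - T (-1) : ℤ[T;T⁻¹]) ≠ 0 := by
  intro h
  have h' := congrArg (fun p : ℤ[T;T⁻¹] => p.coeff 1) h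
  simp [T, -single_eq_C_mul_T, AddMonoidAlgebra.coeff_single] at h'

lemma T_one_mul_T_neg_one : (T 1 * T (-1) : ℤ[T;T⁻¹]) = 1 := by
  rw [← T_add, add_neg_cancel, T_zero]

lemma T_sub_T_mul_sum (B : ℤ) (n : ℕ) :
    (T 1 - T (-1) : ℤ[T;T⁻¹]) * ∑ j ∈ Finset.range (n + 1), T (B - n + 2 * (j : ℤ)) =
      T B * (T (n + 1) - T (-n - 1)) := by
  rw [Finset.mul_sum]
  have h (j : ℕ) : (T 1 - T (-1) : ℤ[T;T⁻¹]) * T (B - n + 2 * (j : ℤ)) =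
      T (B - n - 1 + 2 * ((j + 1 : ℕ) : ℤ)) - T (B - n - 1 + 2 * (j : ℤ)) := by
    rw [sub_mul, ← T_add, ← T_add]
    congr 2 <;> push_cast <;> ring
  simp_rw [h]
  rw [Finset.sum_range_sub (fun j : ℕ => (T (B - n - 1 + 2 * (j : ℤ)) : ℤ[T;T⁻¹])),
    mul_sub, ← T_add, ← T_add]
  congr 2 <;> push_cast <;> ring

lemma T_sub_T_mul_basicMul (A B : ℤ) :
    (T 1 - T (-1)) * toLaurentV (basicMul A B) = T B * (T (A + 1) - T (-A - 1)) := by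
  unfold basicMul
  split_ifs with h₁ h₂
  · obtain ⟨n, rfl⟩ := Int.eq_ofNat_of_zero_le h₁
    simpa [map_sum, toLaurentV_ht] using T_sub_T_mul_sum B n
  · simp [h₂]
  · obtain ⟨n, hn⟩ := Int.eq_ofNat_of_zero_le (show 0 ≤ -A - 2 by omega)
    have h := T_sub_T_mul_sum B n
    rw [hn, map_neg, map_sum]
    simp only [toLaurentV_ht, Int.toNat_natCast, mul_neg]
    rw [h, show A + 1 = -(n : ℤ) - 1 by omega, show -A - 1 = (n : ℤ) + 1 by omega]
    ring

lemma mulV_eq_linearCombination (f g : V) :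
    mulV f g = Finsupp.linearCombination ℤ
      (fun A => Finsupp.linearCombination ℤ (basicMul A) g) f := by
  simp [mulV, Finsupp.linearCombination_apply, Finsupp.smul_sum, mul_smul]

lemma toLaurentV_apply (f : V) : toLaurentV f = Finsupp.linearCombination ℤ T f := by
  have h : (toLaurentV : V →ₗ[ℤ] ℤ[T;T⁻¹]) = Finsupp.linearCombination ℤ T := by
    ext j : 2
    simpa [ht] using toLaurentV_ht j
  exact LinearMap.congr_fun h f

lemma T_sub_T_mul_mulV (f g : V) :
    (T 1 - T (-1)) * toLaurentV (mulV f g) =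
      (T 1 * toLaurentV f - T (-1) * invert (toLaurentV f)) * toLaurentV g := by
  rw [mulV_eq_linearCombination, toLaurentV_apply f, toLaurentV_apply g]
  simp only [Finsupp.linearCombination_apply, Finsupp.sum, map_sum, map_smul, Finset.mul_sum,
    Finset.sum_mul, ← Finset.sum_sub_distrib, mul_smul_comm, smul_mul_assoc,
    T_sub_T_mul_basicMul, Finset.smul_sum, invert_T, ← smul_sub]
  rw [Finset.sum_comm]
  refine Finset.sum_congr rfl fun B _ => Finset.sum_congr rfl fun A _ => ?_
  rw [smul_comm, show A + 1 = 1 + A by ring, show -A - 1 = -1 + -A by ring, T_add, T_add,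
    mul_comm (T B)]

lemma T_sub_T_mul_character (f : V) :
    (T 1 - T (-1)) * character f = T 1 * toLaurentV f - T (-1) * invert (toLaurentV f) := by
  simp [character, T_sub_T_mul_mulV, toLaurentV_ht]

lemma toLaurentV_mulV (f g : V) : toLaurentV (mulV f g) = character f * toLaurentV g := by
  apply mul_left_cancel₀ T_sub_T_ne_zero
  rw [T_sub_T_mul_mulV, ← mul_assoc, T_sub_T_mul_character]

lemma invert_character (f : V) : invert (character f) = character f := by
  apply mul_left_cancel₀ T_sub_T_ne_zero
  have h := congrArg invert (T_sub_T_mul_character f)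
  have hi := involutive_invert (R := ℤ) (toLaurentV f)
  simp only [map_mul, map_sub, invert_T, neg_neg, hi] at h
  linear_combination -h - T_sub_T_mul_character f

lemma character_mulV (f g : V) : character (mulV f g) = character f * character g := by
  apply mul_left_cancel₀ T_sub_T_ne_zero
  rw [T_sub_T_mul_character, toLaurentV_mulV, map_mul, invert_character]
  linear_combination -character f * T_sub_T_mul_character g

lemma mulV_Lmap (f g : V) : mulV (Lmap f) g = mulV f g := by
  have hb (j : ℤ) : character (Lb j) = character (ht j) := by
    apply mul_left_cancel₀ T_sub_T_ne_zero
    simp only [T_sub_T_mul_character]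
    unfold Lb
    split_ifs with h₁ h₂
    · rfl
    · subst h₂
      rw [toLaurentV_ht, invert_T, neg_neg, map_zero, map_zero]
      ring
    · simp only [map_neg, toLaurentV_ht, invert_T, mul_neg, ← T_add]
      rw [show 1 + (-j - 2) = -1 + -j by ring, show -1 + -(-j - 2) = 1 + j by ring]
      ring
  have hm (j : ℤ) : mulV (Lb j) g = mulV (ht j) g :=
    toLaurentV.injective (by rw [toLaurentV_mulV, toLaurentV_mulV, hb])
  simp only [mulV_eq_linearCombination] at hm ⊢
  rw [Lmap, Finsupp.sum, map_sum, Finsupp.linearCombination_apply ℤ f, Finsupp.sum]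
  refine Finset.sum_congr rfl fun j _ => ?_
  rw [map_smul, hm]
  simp [ht]

lemma toLaurentV_hMS_msAdd (M N : Multiset ℤ) :
    toLaurentV (hMS (msAdd M N)) = toLaurentV (hMS M) * toLaurentV (hMS N) := by
  have h (M : Multiset ℤ) : toLaurentV (hMS M) = (M.map T).sum := by
    rw [hMS, map_multiset_sum, Multiset.map_map]
    rfl
  simp only [h, msAdd, Multiset.map_bind, Multiset.sum_bind, Multiset.map_map,
    Function.comp_def, T_add, Multiset.sum_map_mul_left, Multiset.sum_map_mul_right]

lemma T_sub_T_mul_character_of_shift {f g : V} (h : toLaurentV g = T (-1) * toLaurentV f) :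
    (T 1 - T (-1)) * character g = toLaurentV f - invert (toLaurentV f) := by
  rw [T_sub_T_mul_character, h, map_mul, invert_T, neg_neg]
  linear_combination (toLaurentV f - invert (toLaurentV f)) * T_one_mul_T_neg_one

lemma character_ht_one : character (ht 1) = T 1 + T (-1) := by
  apply mul_left_cancel₀ T_sub_T_ne_zero
  rw [T_sub_T_mul_character, toLaurentV_ht, invert_T]
  ring

lemma toLaurentV_eZ_one (n : ℕ) :
    toLaurentV (eZ n).2.1 = T (-1) * toLaurentV (eZ n).1 := by
  induction n with
  | zero => simp only [eZ, toLaurentV_ht, ← T_add]; norm_num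
  | succ n ih =>
    simp only [eZ, map_sub, map_add, toLaurentV_mulV, character_mulV, character_ht_one, ih]
    linear_combination
      -character (eZ n).1 * character (eZ n).2.1 * toLaurentV (eZ n).1 * T_one_mul_T_neg_one

lemma toLaurentV_eZ_succ (n : ℕ) :
    toLaurentV (eZ (n + 1)).1 = character (eZ n).1 * toLaurentV (eZ n).1 ^ 2 := by
  have ih := toLaurentV_eZ_one n
  have h₀ := T_sub_T_mul_character (eZ n).1
  have h₁ := T_sub_T_mul_character_of_shift ih
  simp only [eZ, map_sub, toLaurentV_mulV, ih]
  congr 1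
  apply mul_left_cancel₀ T_sub_T_ne_zero
  linear_combination toLaurentV (eZ n).1 * h₀ - T (-1) * toLaurentV (eZ n).1 * h₁

end

/-- For every `n ≥ 0`, if `M` is a finite multiset with `ẽ(n,0,0) = h̃(M)`, then
`ẽ(n+1,0,0) = L(ẽ(n,0,0)) · h̃(M + M)`, where `M + M` is the multiset sum. -/
theorem stmt14 (n : ℕ) (M : Multiset ℤ) (hM : etilde0 n 0 = hMS M) :
    etilde0 (n + 1) 0 = mulV (Lmap (etilde0 n 0)) (hMS (msAdd M M)) := by
  change (eZ n).1 = hMS M at hM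
  change (eZ (n + 1)).1 = mulV (Lmap (eZ n).1) (hMS (msAdd M M))
  apply toLaurentV.injective
  rw [mulV_Lmap, toLaurentV_mulV, toLaurentV_hMS_msAdd, ← hM, toLaurentV_eZ_succ, sq]
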